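/- arXiv:2604.12835 — 4 statements merged into one kernel-verified Lean document; each statement's English description precedes it below -/
import Mathlib

section
/- Let φ₀ ∈ (0, π/2] be a real number and let A, B, C ∈ ℂ. Set Z = C sin φ₀ - B cos φ₀ and D = C cos φ₀ + B sin φ₀. Assume: C cos φ + B sin φ ≠ 0 for all φ ∈ [0, φ₀]; A cos θ + C sin θ ≠ 0 and A cos θ + D sin θ ≠ 0 for all θ ∈ [0, π/2]; and A² + C² ≠ 0, B² + C² ≠ 0, A² + D² ≠ 0. Then ∫_0^{φ₀} A (C cos φ + B sin φ)^{-2} dφ + ∫_0^{π/2} B (A cos θ + C sin θ)^{-2} dθ + ∫_0^{π/2} Z (A cos θ + D sin θ)^{-2} dθ = sin φ₀ · (A² + B² + C²)/(A C D). (Note that A ≠ 0, C ≠ 0 and D ≠ 0 follow from the nonvanishing hypotheses at the endpoints.) -/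
/-- Antiderivative evaluation: the primitive is `sin / (P (P cos + Q sin))`. -/
lemma integral_aux (t : ℝ) (ht : 0 ≤ t) (K P Q : ℂ)
    (h : ∀ φ ∈ Set.Icc (0 : ℝ) t, P * (Real.cos φ : ℂ) + Q * (Real.sin φ : ℂ) ≠ 0) :
    (∫ φ in (0 : ℝ)..t, K * (P * (Real.cos φ : ℂ) + Q * (Real.sin φ : ℂ)) ^ (-2 : ℤ))
      = K * (Real.sin t : ℂ) / (P * (P * (Real.cos t : ℂ) + Q * (Real.sin t : ℂ))) := by
  have hP : P ≠ 0 := by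
    have := h 0 ⟨le_refl _, ht⟩
    simpa using this
  have hu : Set.uIcc 0 t = Set.Icc 0 t := Set.uIcc_of_le ht
  rw [intervalIntegral.integral_eq_sub_of_hasDerivAt
    (f := fun φ : ℝ => K * (Real.sin φ : ℂ) /
      (P * (P * (Real.cos φ : ℂ) + Q * (Real.sin φ : ℂ))))]
  · simp
  · intro x hx
    rw [hu] at hx
    have hq := h x hx
    have hs : HasDerivAt (fun φ : ℝ => (Real.sin φ : ℂ)) (Real.cos x : ℂ) x :=
      (Real.hasDerivAt_sin x).ofReal_comp
    have hc : HasDerivAt (fun φ : ℝ => (Real.cos φ : ℂ)) ((-Real.sin x : ℝ) : ℂ) x :=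
      (Real.hasDerivAt_cos x).ofReal_comp
    have hd := (hs.const_mul K).fun_div (((hc.const_mul P).fun_add (hs.const_mul Q)).const_mul P)
      (mul_ne_zero hP hq)
    refine hd.congr_deriv ?_
    have hsc : (Real.sin x : ℂ) ^ 2 + (Real.cos x : ℂ) ^ 2 = 1 := by
      exact_mod_cast Real.sin_sq_add_cos_sq x
    rw [zpow_neg, Complex.ofReal_neg]
    generalize (Real.sin x : ℂ) = s at *
    generalize (Real.cos x : ℂ) = c at *
    have e : (P * c + Q * s) ^ (2 : ℤ) = (P * c + Q * s) ^ 2 := by norm_cast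
    rw [e, ← div_eq_mul_inv, div_eq_div_iff (pow_ne_zero 2 (mul_ne_zero hP hq))
      (pow_ne_zero 2 hq)]
    linear_combination (K * P ^ 2 * (P * c + Q * s) ^ 2) * hsc
  · apply ContinuousOn.intervalIntegrable
    rw [hu]
    refine continuousOn_const.mul (ContinuousOn.zpow₀ ?_ _ fun x hx => Or.inl (h x hx))
    fun_prop

/-- Equation (eq 622) of the paper: the closed-form evaluation of the leading
boundary-integral sum over the three planar faces of the three-dimensional test domain. -/
theorem stmt_6 (φ₀ : ℝ) (hφ₀ : φ₀ ∈ Set.Ioc 0 (Real.pi / 2)) (A B C Z D : ℂ)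
    (hZ : Z = C * (Real.sin φ₀ : ℂ) - B * (Real.cos φ₀ : ℂ))
    (hD : D = C * (Real.cos φ₀ : ℂ) + B * (Real.sin φ₀ : ℂ))
    (h1 : ∀ φ ∈ Set.Icc (0 : ℝ) φ₀,
      C * (Real.cos φ : ℂ) + B * (Real.sin φ : ℂ) ≠ 0)
    (h2 : ∀ θ ∈ Set.Icc (0 : ℝ) (Real.pi / 2),
      A * (Real.cos θ : ℂ) + C * (Real.sin θ : ℂ) ≠ 0)
    (h3 : ∀ θ ∈ Set.Icc (0 : ℝ) (Real.pi / 2),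
      A * (Real.cos θ : ℂ) + D * (Real.sin θ : ℂ) ≠ 0)
    (hAC : A ^ 2 + C ^ 2 ≠ 0) (hBC : B ^ 2 + C ^ 2 ≠ 0) (hAD : A ^ 2 + D ^ 2 ≠ 0) :
    (∫ φ in (0 : ℝ)..φ₀,
        A * (C * (Real.cos φ : ℂ) + B * (Real.sin φ : ℂ)) ^ (-2 : ℤ))
    + (∫ θ in (0 : ℝ)..(Real.pi / 2),
        B * (A * (Real.cos θ : ℂ) + C * (Real.sin θ : ℂ)) ^ (-2 : ℤ))
    + (∫ θ in (0 : ℝ)..(Real.pi / 2),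
        Z * (A * (Real.cos θ : ℂ) + D * (Real.sin θ : ℂ)) ^ (-2 : ℤ))
      = (Real.sin φ₀ : ℂ) * (A ^ 2 + B ^ 2 + C ^ 2) / (A * C * D) := by
  have hpi : (0 : ℝ) ≤ Real.pi / 2 := by positivity
  have hA : A ≠ 0 := by simpa using h2 0 ⟨le_refl _, hpi⟩
  have hC : C ≠ 0 := by simpa using h1 0 ⟨le_refl _, hφ₀.1.le⟩
  have hD0 : D ≠ 0 := by rw [hD]; exact h1 φ₀ ⟨hφ₀.1.le, le_refl _⟩
  rw [integral_aux _ hφ₀.1.le _ _ _ h1, integral_aux _ hpi _ _ _ h2,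
    integral_aux _ hpi _ _ _ h3, ← hD, Real.sin_pi_div_two, Real.cos_pi_div_two]
  simp only [Complex.ofReal_one, Complex.ofReal_zero, mul_one, mul_zero, zero_add]
  generalize (Real.sin φ₀ : ℂ) = s at *
  generalize (Real.cos φ₀ : ℂ) = c at *
  field_simp
  linear_combination C * hZ + B * hD
end

section
/- Let ϑ ≥ 1, φ₀ ∈ (0, π/2], ψ₁ ∈ (π/2, π) and ψ₂ ∈ (φ₀ + π/2, 3π/2) be real numbers. Define A = -cos ψ₁ ∈ ℝ, B = -sin ψ₁ sin ψ₂ - i ϑ cos ψ₂ ∈ ℂ, C = -sin ψ₁ cos ψ₂ + i ϑ sin ψ₂ ∈ ℂ, and D = C cos φ₀ + B sin φ₀. Then: (i) A² + B² + C² = 1 - ϑ²; (ii) A > 0; (iii) Re(C cos φ + B sin φ) > 0 for every φ ∈ [0, φ₀]; (iv) Re(A cos θ + C sin θ) > 0 for every θ ∈ [0, π/2]; (v) Re(A cos θ + D sin θ) > 0 for every θ ∈ [0, π/2]. In particular, all the denominators C cos φ + B sin φ, A cos θ + C sin θ, A cos θ + D sin θ, as well as A, C and D, are nonzero on the indicated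 ranges. -/
theorem stmt7_aux (a : ℝ) (ha : 0 < a) (Z : ℂ) (hZ : 0 < Z.re) (θ : ℝ)
    (hθ : θ ∈ Set.Icc (0 : ℝ) (Real.pi / 2)) :
    0 < ((a : ℂ) * (Real.cos θ : ℂ) + Z * (Real.sin θ : ℂ)).re := by
  rw [Complex.add_re, Complex.re_mul_ofReal, Complex.re_mul_ofReal, Complex.ofReal_re]
  obtain ⟨h0, h1⟩ := hθ
  have hpi := Real.pi_pos
  have hc : 0 ≤ Real.cos θ := Real.cos_nonneg_of_mem_Icc ⟨by linarith, h1⟩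
  rcases h0.eq_or_lt with h | h
  · subst h
    simpa using ha
  · have hs : 0 < Real.sin θ := Real.sin_pos_of_pos_of_lt_pi h (by linarith)
    have := mul_pos hZ hs
    have := mul_nonneg ha.le hc
    linarith

/-- Properties of the coefficients A, B, C, D (equation (eq ABC) of the paper):
the identity A² + B² + C² = 1 - ϑ², positivity of A, positivity of the real parts of
the Laplace-transform denominators on the admissible angular ranges, and the resulting
nonvanishing statements. -/
theorem stmt_7 (ϑ φ₀ ψ₁ ψ₂ : ℝ) (hϑ : 1 ≤ ϑ)
    (hφ₀ : φ₀ ∈ Set.Ioc 0 (Real.pi / 2))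
    (hψ₁ : ψ₁ ∈ Set.Ioo (Real.pi / 2) Real.pi)
    (hψ₂ : ψ₂ ∈ Set.Ioo (φ₀ + Real.pi / 2) (3 * Real.pi / 2)) :
    let A : ℝ := -Real.cos ψ₁
    let B : ℂ := -((Real.sin ψ₁ * Real.sin ψ₂ : ℝ) : ℂ)
      - Complex.I * ((ϑ * Real.cos ψ₂ : ℝ) : ℂ)
    let C : ℂ := -((Real.sin ψ₁ * Real.cos ψ₂ : ℝ) : ℂ)
      + Complex.I * ((ϑ * Real.sin ψ₂ : ℝ) : ℂ)
    let D : ℂ := C * (Real.cos φ₀ : ℂ) + B * (Real.sin φ₀ : ℂ)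
    ((A : ℂ) ^ 2 + B ^ 2 + C ^ 2 = 1 - (ϑ : ℂ) ^ 2) ∧
    (0 < A) ∧
    (∀ φ ∈ Set.Icc (0 : ℝ) φ₀,
      0 < (C * (Real.cos φ : ℂ) + B * (Real.sin φ : ℂ)).re) ∧
    (∀ θ ∈ Set.Icc (0 : ℝ) (Real.pi / 2),
      0 < ((A : ℂ) * (Real.cos θ : ℂ) + C * (Real.sin θ : ℂ)).re) ∧
    (∀ θ ∈ Set.Icc (0 : ℝ) (Real.pi / 2),
      0 < ((A : ℂ) * (Real.cos θ : ℂ) + D * (Real.sin θ : ℂ)).re) ∧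
    (∀ φ ∈ Set.Icc (0 : ℝ) φ₀,
      C * (Real.cos φ : ℂ) + B * (Real.sin φ : ℂ) ≠ 0) ∧
    (∀ θ ∈ Set.Icc (0 : ℝ) (Real.pi / 2),
      (A : ℂ) * (Real.cos θ : ℂ) + C * (Real.sin θ : ℂ) ≠ 0) ∧
    (∀ θ ∈ Set.Icc (0 : ℝ) (Real.pi / 2),
      (A : ℂ) * (Real.cos θ : ℂ) + D * (Real.sin θ : ℂ) ≠ 0) ∧
    ((A : ℂ) ≠ 0) ∧ (C ≠ 0) ∧ (D ≠ 0) := by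
  intro A B C D
  obtain ⟨hφ0, hφ1⟩ := hφ₀
  obtain ⟨h10, h11⟩ := hψ₁
  obtain ⟨h20, h21⟩ := hψ₂
  have hpi := Real.pi_pos
  have nz : ∀ z : ℂ, 0 < z.re → z ≠ 0 := by
    rintro z hz rfl
    simp at hz
  have hA : 0 < A := by
    have := Real.cos_neg_of_pi_div_two_lt_of_lt h10 (by linarith)
    simp only [A]
    linarith
  have hs1 : 0 < Real.sin ψ₁ := Real.sin_pos_of_pos_of_lt_pi (by linarith) h11
  have h3 : ∀ φ ∈ Set.Icc (0 : ℝ) φ₀,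
      0 < (C * (Real.cos φ : ℂ) + B * (Real.sin φ : ℂ)).re := by
    rintro φ ⟨ha, hb⟩
    have hc : Real.cos (ψ₂ - φ) < 0 :=
      Real.cos_neg_of_pi_div_two_lt_of_lt (by linarith) (by linarith)
    have hm := mul_pos hs1 (neg_pos.2 hc)
    rw [Real.cos_sub] at hm
    have hCre : C.re = -(Real.sin ψ₁ * Real.cos ψ₂) := by
      simp only [C, Complex.add_re, Complex.neg_re, Complex.re_mul_ofReal, Complex.ofReal_re,
        Complex.I_re]
      ring
    have hBre : B.re = -(Real.sin ψ₁ * Real.sin ψ₂) := by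
      simp only [B, Complex.sub_re, Complex.neg_re, Complex.re_mul_ofReal, Complex.ofReal_re,
        Complex.I_re]
      ring
    rw [Complex.add_re, Complex.re_mul_ofReal, Complex.re_mul_ofReal, hCre, hBre]
    linarith
  have hC : 0 < C.re := by
    have := h3 0 ⟨le_rfl, hφ0.le⟩
    simpa only [Real.cos_zero, Real.sin_zero, Complex.ofReal_one, Complex.ofReal_zero, mul_one,
      mul_zero, add_zero] using this
  have hD : 0 < D.re := h3 φ₀ ⟨hφ0.le, le_rfl⟩
  have h4 := stmt7_aux A hA C hC
  have h5 := stmt7_aux A hA D hD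
  refine ⟨?_, hA, h3, h4, h5, fun φ h => nz _ (h3 φ h), fun θ h => nz _ (h4 θ h),
    fun θ h => nz _ (h5 θ h), nz _ (by simpa using hA), nz _ hC, nz _ hD⟩
  have e1 : (Real.sin ψ₁ : ℂ) ^ 2 + (Real.cos ψ₁ : ℂ) ^ 2 = 1 := by
    exact_mod_cast Real.sin_sq_add_cos_sq ψ₁
  have e2 : (Real.sin ψ₂ : ℂ) ^ 2 + (Real.cos ψ₂ : ℂ) ^ 2 = 1 := by
    exact_mod_cast Real.sin_sq_add_cos_sq ψ₂
  simp only [A, B, C, Complex.ofReal_neg, Complex.ofReal_mul]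
  linear_combination e1 + ((Real.sin ψ₁ : ℂ) ^ 2 - (ϑ : ℂ) ^ 2) * e2 +
    (ϑ : ℂ) ^ 2 * ((Real.sin ψ₂ : ℂ) ^ 2 + (Real.cos ψ₂ : ℂ) ^ 2) * Complex.I_sq
end

section
/- Let k > 0, τ > 0, θ₀ ∈ (0, π/2], ψ ∈ (θ₀ + π/2, 3π/2) be real numbers, let N ≥ 1 be an integer, and let a, b ∈ ℂ. Set ϑ = √(1 + k²/τ²), d = (cos ψ, sin ψ), d⊥ = (-sin ψ, cos ψ), ρ = τ d + i τ ϑ d⊥ ∈ ℂ², and u₀(x) = exp(ρ · x) for x ∈ ℝ². Define v : ℝ² → ℂ by v(x₁, x₂) = (i^N k^N/(2^N N!)) (a (x₁ + i x₂)^N + b (x₁ - i x₂)^N), and set ν₄ = (0, -1), ν₅ = (-sin θ₀, cos θ₀). Define G = -sin ψ - i ϑ cos ψ, H = sin(ψ - θ₀) + i ϑ cos(ψ - θ₀), L = -cos ψ + i ϑ sin ψ, J = -cos(ψ - θ₀) + i ϑ sin(ψ - θ₀), q₁ = (i^N k^N/2^N)(a + b), q₂ = (i^N k^N/2^N)(a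 e^{i N θ₀} + b e^{-i N θ₀}), q₃ = (i^N k^N/2^N)(i a e^{i N θ₀} - i b e^{-i N θ₀}). Then the improper integrals below converge and ∫_0^∞ v(t, 0) (ρ · ν₄) u₀(t, 0) dt + ∫_0^∞ v(t cos θ₀, t sin θ₀) (ρ · ν₅) u₀(t cos θ₀, t sin θ₀) dt - ∫_0^∞ (D_{ν₅} v)(t cos θ₀, t sin θ₀) u₀(t cos θ₀, t sin θ₀) dt = τ^{-N} ( G q₁/L^{N+1} + H q₂/J^{N+1} - q₃/J^N ), where D_{ν₅} v denotes the directional derivative of v in the direction ν₅. -/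
open MeasureTheory

lemma aux_integrable (z : ℂ) (hz : 0 < z.re) (n : ℕ) :
    IntegrableOn (fun t : ℝ => (t : ℂ) ^ n * Complex.exp (-z * t)) (Set.Ioi 0) := by
  have h := integrableOn_rpow_mul_exp_neg_mul_rpow (p := 1) (s := n) (b := z.re)
    (by have : (0 : ℝ) ≤ n := Nat.cast_nonneg n
        linarith) one_pos hz
  refine Integrable.mono' h ?_ ?_
  · exact (by fun_prop : Continuous (fun t : ℝ => (t : ℂ) ^ n * Complex.exp (-z * t))).aestronglyMeasurable
  · refine (ae_restrict_iff' measurableSet_Ioi).2 (Filter.Eventually.of_forall fun t ht => ?_)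
    have ht' : (0 : ℝ) < t := ht
    rw [norm_mul, norm_pow, Complex.norm_real, Complex.norm_exp, Real.norm_of_nonneg ht'.le]
    simp

lemma aux_tendsto (z : ℂ) (hz : 0 < z.re) (n : ℕ) :
    Filter.Tendsto (fun t : ℝ => (t : ℂ) ^ n * Complex.exp (-z * t)) Filter.atTop (nhds 0) := by
  rw [tendsto_zero_iff_norm_tendsto_zero]
  have h := tendsto_rpow_mul_exp_neg_mul_atTop_nhds_zero (n : ℝ) z.re hz
  refine h.congr' ?_
  filter_upwards [Filter.eventually_gt_atTop 0] with t ht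
  rw [norm_mul, norm_pow, Complex.norm_real, Complex.norm_exp, Real.norm_of_nonneg ht.le]
  simp

lemma aux_integral (z : ℂ) (hz : 0 < z.re) (n : ℕ) :
    ∫ t in Set.Ioi (0 : ℝ), (t : ℂ) ^ n * Complex.exp (-z * t)
      = (n.factorial : ℂ) / z ^ (n + 1) := by
  have hz0 : z ≠ 0 := by
    rintro rfl
    simp at hz
  induction n with
  | zero =>
    have := integral_exp_mul_complex_Ioi (a := -z) (by simpa using hz) 0
    simp only [pow_zero, one_mul]
    rw [this]
    simp
  | succ n ih =>
    have hd : ∀ t : ℝ, HasDerivAt (fun t : ℝ => (t : ℂ) ^ (n + 1) * Complex.exp (-z * t))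
        ((n + 1 : ℂ) * ((t : ℂ) ^ n * Complex.exp (-z * t))
          - z * ((t : ℂ) ^ (n + 1) * Complex.exp (-z * t))) t := by
      intro t
      have h1 : HasDerivAt (fun s : ℂ => s ^ (n + 1) * Complex.exp (-z * s))
        ((n + 1 : ℂ) * ((t : ℂ) ^ n * Complex.exp (-z * t))
          - z * ((t : ℂ) ^ (n + 1) * Complex.exp (-z * t))) (t : ℂ) := by
        have := (hasDerivAt_pow (n + 1) (t : ℂ)).mul
          (((hasDerivAt_id (t : ℂ)).const_mul (-z)).cexp)
        refine HasDerivAt.congr_deriv this ?_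
        simp
        ring
      exact h1.comp_ofReal
    have hi1 := (aux_integrable z hz n).const_mul (n + 1 : ℂ)
    have hi2 := (aux_integrable z hz (n + 1)).const_mul z
    have key := integral_Ioi_of_hasDerivAt_of_tendsto' (a := 0) (fun t _ => hd t) (hi1.sub hi2)
      (aux_tendsto z hz (n + 1))
    rw [integral_sub hi1 hi2, integral_const_mul, integral_const_mul, ih] at key
    simp only [Complex.ofReal_zero, ne_eq, Nat.add_eq_zero_iff, one_ne_zero, and_false,
      not_false_eq_true, zero_pow, zero_mul, sub_zero] at key
    have h2 := (sub_eq_zero.1 key).symm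
    rw [eq_div_iff (pow_ne_zero _ hz0), pow_succ, ← mul_assoc, mul_right_comm, mul_comm _ z, h2]
    rw [Nat.factorial_succ]
    push_cast
    field_simp

/-- scaled version -/
lemma aux_scaled (c z : ℂ) (hz : 0 < z.re) (n : ℕ) (f : ℝ → ℂ)
    (hf : ∀ t, f t = c * ((t : ℂ) ^ n * Complex.exp (-z * t))) :
    IntegrableOn f (Set.Ioi 0) ∧
      ∫ t in Set.Ioi (0 : ℝ), f t = c * ((n.factorial : ℂ) / z ^ (n + 1)) := by
  obtain rfl : f = _ := funext hf
  refine ⟨(aux_integrable z hz n).const_mul c, ?_⟩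
  rw [integral_const_mul, aux_integral z hz n]

lemma aux_fderiv (c a b : ℂ) (N : ℕ) (x w : ℝ × ℝ) :
    fderiv ℝ (fun x : ℝ × ℝ => c * (a * ((x.1 : ℂ) + Complex.I * (x.2 : ℂ)) ^ N
          + b * ((x.1 : ℂ) - Complex.I * (x.2 : ℂ)) ^ N)) x w =
    c * (a * (N * ((x.1 : ℂ) + Complex.I * (x.2 : ℂ)) ^ (N - 1)
        * ((w.1 : ℂ) + Complex.I * (w.2 : ℂ)))
      + b * (N * ((x.1 : ℂ) - Complex.I * (x.2 : ℂ)) ^ (N - 1)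
        * ((w.1 : ℂ) - Complex.I * (w.2 : ℂ)))) := by
  have h1 : HasFDerivAt (fun x : ℝ × ℝ => (x.1 : ℂ))
      (Complex.ofRealCLM.comp (ContinuousLinearMap.fst ℝ ℝ ℝ)) x :=
    (Complex.ofRealCLM.comp (ContinuousLinearMap.fst ℝ ℝ ℝ)).hasFDerivAt
  have h2 : HasFDerivAt (fun x : ℝ × ℝ => (x.2 : ℂ))
      (Complex.ofRealCLM.comp (ContinuousLinearMap.snd ℝ ℝ ℝ)) x :=
    (Complex.ofRealCLM.comp (ContinuousLinearMap.snd ℝ ℝ ℝ)).hasFDerivAt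
  have h := ((((h1.add (h2.const_mul Complex.I)).pow N).const_mul a).add
    (((h1.sub (h2.const_mul Complex.I)).pow N).const_mul b)).const_mul c
  have h' := h.fderiv
  simp only [Pi.add_apply, Pi.sub_apply] at h'
  refine (congrArg (fun L => L w) h').trans ?_
  simp
  ring

/-- Step I of the proof of Proposition 5.3 of the paper: exact evaluation of the
planar ATD ray integrals over the two extended sides of the test domain
(equations (eq nu45)–(eq G)). -/
theorem stmt_8 (k τ θ₀ ψ : ℝ) (hk : 0 < k) (hτ : 0 < τ)
    (hθ₀ : θ₀ ∈ Set.Ioc 0 (Real.pi / 2))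
    (hψ : ψ ∈ Set.Ioo (θ₀ + Real.pi / 2) (3 * Real.pi / 2))
    (N : ℕ) (hN : 1 ≤ N) (a b : ℂ) :
    let ϑ : ℝ := Real.sqrt (1 + k ^ 2 / τ ^ 2)
    let ρ₁ : ℂ := ((τ * Real.cos ψ : ℝ) : ℂ)
      + Complex.I * ((τ * ϑ * (-Real.sin ψ) : ℝ) : ℂ)
    let ρ₂ : ℂ := ((τ * Real.sin ψ : ℝ) : ℂ)
      + Complex.I * ((τ * ϑ * Real.cos ψ : ℝ) : ℂ)
    let u₀ : ℝ × ℝ → ℂ := fun x => Complex.exp (ρ₁ * (x.1 : ℂ) + ρ₂ * (x.2 : ℂ))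
    let v : ℝ × ℝ → ℂ := fun x =>
      Complex.I ^ N * (k : ℂ) ^ N / (2 ^ N * (N.factorial : ℂ)) *
        (a * ((x.1 : ℂ) + Complex.I * (x.2 : ℂ)) ^ N
          + b * ((x.1 : ℂ) - Complex.I * (x.2 : ℂ)) ^ N)
    let ν₄ : ℝ × ℝ := (0, -1)
    let ν₅ : ℝ × ℝ := (-Real.sin θ₀, Real.cos θ₀)
    let G : ℂ := -((Real.sin ψ : ℝ) : ℂ) - Complex.I * ((ϑ * Real.cos ψ : ℝ) : ℂ)
    let H : ℂ := ((Real.sin (ψ - θ₀) : ℝ) : ℂ)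
      + Complex.I * ((ϑ * Real.cos (ψ - θ₀) : ℝ) : ℂ)
    let L : ℂ := -((Real.cos ψ : ℝ) : ℂ) + Complex.I * ((ϑ * Real.sin ψ : ℝ) : ℂ)
    let J : ℂ := -((Real.cos (ψ - θ₀) : ℝ) : ℂ)
      + Complex.I * ((ϑ * Real.sin (ψ - θ₀) : ℝ) : ℂ)
    let q₁ : ℂ := Complex.I ^ N * (k : ℂ) ^ N / 2 ^ N * (a + b)
    let q₂ : ℂ := Complex.I ^ N * (k : ℂ) ^ N / 2 ^ N *
      (a * Complex.exp (Complex.I * (N : ℂ) * (θ₀ : ℂ))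
        + b * Complex.exp (-(Complex.I * (N : ℂ) * (θ₀ : ℂ))))
    let q₃ : ℂ := Complex.I ^ N * (k : ℂ) ^ N / 2 ^ N *
      (Complex.I * a * Complex.exp (Complex.I * (N : ℂ) * (θ₀ : ℂ))
        - Complex.I * b * Complex.exp (-(Complex.I * (N : ℂ) * (θ₀ : ℂ))))
    let f₁ : ℝ → ℂ := fun t =>
      v (t, 0) * (ρ₁ * (ν₄.1 : ℂ) + ρ₂ * (ν₄.2 : ℂ)) * u₀ (t, 0)
    let f₂ : ℝ → ℂ := fun t =>
      v (t * Real.cos θ₀, t * Real.sin θ₀)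
        * (ρ₁ * (ν₅.1 : ℂ) + ρ₂ * (ν₅.2 : ℂ))
        * u₀ (t * Real.cos θ₀, t * Real.sin θ₀)
    let f₃ : ℝ → ℂ := fun t =>
      fderiv ℝ v (t * Real.cos θ₀, t * Real.sin θ₀) ν₅
        * u₀ (t * Real.cos θ₀, t * Real.sin θ₀)
    IntegrableOn f₁ (Set.Ioi 0) ∧
    IntegrableOn f₂ (Set.Ioi 0) ∧
    IntegrableOn f₃ (Set.Ioi 0) ∧
    (∫ t in Set.Ioi (0 : ℝ), f₁ t) + (∫ t in Set.Ioi (0 : ℝ), f₂ t)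
        - (∫ t in Set.Ioi (0 : ℝ), f₃ t)
      = ((τ : ℂ) ^ N)⁻¹ *
          (G * q₁ / L ^ (N + 1) + H * q₂ / J ^ (N + 1) - q₃ / J ^ N) := by
  intro ϑ ρ₁ ρ₂ u₀ v ν₄ ν₅ G H L J q₁ q₂ q₃ f₁ f₂ f₃
  have hτ0 : (τ : ℂ) ≠ 0 := by exact_mod_cast hτ.ne'
  have hc1 : Real.cos ψ < 0 :=
    Real.cos_neg_of_pi_div_two_lt_of_lt (by linarith [hψ.1, hθ₀.1]) (by linarith [hψ.2])
  have hc2 : Real.cos (ψ - θ₀) < 0 :=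
    Real.cos_neg_of_pi_div_two_lt_of_lt (by linarith [hψ.1, hθ₀.1])
      (by linarith [hψ.2, hθ₀.1])
  have hLre : 0 < L.re := by
    simp only [L, Complex.add_re, Complex.neg_re, Complex.ofReal_re, Complex.re_mul_ofReal,
      Complex.I_re]
    linarith
  have hJre : 0 < J.re := by
    simp only [J, Complex.add_re, Complex.neg_re, Complex.ofReal_re, Complex.re_mul_ofReal,
      Complex.I_re]
    linarith
  have hzL : 0 < ((τ : ℂ) * L).re := by
    rw [Complex.re_ofReal_mul]
    positivity
  have hzJ : 0 < ((τ : ℂ) * J).re := by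
    rw [Complex.re_ofReal_mul]
    positivity
  have hL0 : L ≠ 0 := by
    intro h
    simp [h] at hLre
  have hJ0 : J ≠ 0 := by
    intro h
    simp [h] at hJre
  have hfac : (N.factorial : ℂ) ≠ 0 := by exact_mod_cast N.factorial_ne_zero
  have hI : Complex.I * Complex.I = -1 := Complex.I_mul_I
  -- the unit vectors as exponentials
  obtain ⟨e, he⟩ : ∃ e, e = Complex.exp (Complex.I * (θ₀ : ℂ)) := ⟨_, rfl⟩
  obtain ⟨e', he'⟩ : ∃ e', e' = Complex.exp (-(Complex.I * (θ₀ : ℂ))) := ⟨_, rfl⟩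
  have hce : ((Real.cos θ₀ : ℝ) : ℂ) + Complex.I * ((Real.sin θ₀ : ℝ) : ℂ) = e := by
    rw [he, mul_comm Complex.I (θ₀ : ℂ), Complex.exp_mul_I]
    push_cast
    ring
  have hce' : ((Real.cos θ₀ : ℝ) : ℂ) - Complex.I * ((Real.sin θ₀ : ℝ) : ℂ) = e' := by
    rw [he', show -(Complex.I * (θ₀ : ℂ)) = (-(θ₀ : ℂ)) * Complex.I by ring,
      Complex.exp_mul_I, Complex.cos_neg, Complex.sin_neg]
    push_cast
    ring
  have heN : Complex.exp (Complex.I * (N : ℂ) * (θ₀ : ℂ)) = e ^ N := by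
    rw [he, ← Complex.exp_nat_mul]
    congr 1
    ring
  have heN' : Complex.exp (-(Complex.I * (N : ℂ) * (θ₀ : ℂ))) = e' ^ N := by
    rw [he', ← Complex.exp_nat_mul]
    congr 1
    ring
  have hρ1 : ρ₁ = -((τ : ℂ) * L) := by
    simp only [ρ₁, L]
    push_cast
    ring
  have hρ2 : ρ₂ = -((τ : ℂ) * G) := by
    simp only [ρ₂, G]
    push_cast
    ring
  have hρJ : ρ₁ * ((Real.cos θ₀ : ℝ) : ℂ) + ρ₂ * ((Real.sin θ₀ : ℝ) : ℂ)
      = -((τ : ℂ) * J) := by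
    simp only [ρ₁, ρ₂, J, Real.cos_sub, Real.sin_sub]
    push_cast
    ring
  have hρH : ρ₁ * ((-Real.sin θ₀ : ℝ) : ℂ) + ρ₂ * ((Real.cos θ₀ : ℝ) : ℂ)
      = (τ : ℂ) * H := by
    simp only [ρ₁, ρ₂, H, Real.cos_sub, Real.sin_sub]
    push_cast
    ring
  have hu : ∀ t : ℝ, u₀ (t * Real.cos θ₀, t * Real.sin θ₀)
      = Complex.exp (-((τ : ℂ) * J) * t) := by
    intro t
    simp only [u₀]
    rw [← hρJ]
    congr 1
    push_cast
    ring
  have hp : ∀ t : ℝ, ((t * Real.cos θ₀ : ℝ) : ℂ) + Complex.I * ((t * Real.sin θ₀ : ℝ) : ℂ)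
      = t * e := by
    intro t
    rw [← hce]
    push_cast
    ring
  have hm : ∀ t : ℝ, ((t * Real.cos θ₀ : ℝ) : ℂ) - Complex.I * ((t * Real.sin θ₀ : ℝ) : ℂ)
      = t * e' := by
    intro t
    rw [← hce']
    push_cast
    ring
  have hwp : ((-Real.sin θ₀ : ℝ) : ℂ) + Complex.I * ((Real.cos θ₀ : ℝ) : ℂ)
      = Complex.I * e := by
    rw [← hce]
    push_cast
    linear_combination (-(Complex.sin θ₀)) * hI
  have hwm : ((-Real.sin θ₀ : ℝ) : ℂ) - Complex.I * ((Real.cos θ₀ : ℝ) : ℂ)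
      = -Complex.I * e' := by
    rw [← hce']
    push_cast
    linear_combination (-(Complex.sin θ₀)) * hI
  obtain ⟨i1, v1⟩ := aux_scaled (q₁ / N.factorial * (τ * G)) (τ * L) hzL N f₁ (by
    intro t
    simp only [f₁, v, u₀, ν₄, q₁, hρ1, hρ2, Complex.ofReal_zero, mul_zero, add_zero, sub_zero]
    push_cast
    field_simp
    try ring)
  obtain ⟨i2, v2⟩ := aux_scaled (q₂ / N.factorial * (τ * H)) (τ * J) hzJ N f₂ (by
    intro t
    simp only [f₂, ν₅]
    rw [hu, hρH]
    simp only [v, q₂]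
    rw [hp, hm, heN, heN', mul_pow, mul_pow]
    field_simp)
  obtain ⟨M, rfl⟩ : ∃ M, N = M + 1 := ⟨N - 1, by omega⟩
  obtain ⟨i3, v3⟩ := aux_scaled (q₃ / M.factorial) (τ * J) hzJ M f₃ (by
    intro t
    have hM : (M.factorial : ℂ) ≠ 0 := by exact_mod_cast M.factorial_ne_zero
    have hM1 : (M : ℂ) + 1 ≠ 0 := by exact_mod_cast M.succ_ne_zero
    simp only [f₃, ν₅]
    rw [hu]
    simp only [v, q₃]
    rw [aux_fderiv]
    dsimp only
    rw [hp, hm, hwp, hwm, heN, heN', Nat.add_sub_cancel, mul_pow, mul_pow, Nat.factorial_succ]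
    push_cast
    field_simp
    ring)
  refine ⟨i1, i2, i3, ?_⟩
  rw [v1, v2, v3]
  have hM : (M.factorial : ℂ) ≠ 0 := by exact_mod_cast M.factorial_ne_zero
  clear_value G H L J q₁ q₂ q₃
  simp only [mul_pow]
  field_simp
  try ring
end

section
/- Let k > 0, τ > 0, φ₀ ∈ (0, π/2], ψ₁ ∈ (π/2, π) and ψ₂ ∈ (φ₀ + π/2, 3π/2) be real numbers. Set ϑ = √(1 + k²/τ²), d = (sin ψ₁ cos ψ₂, sin ψ₁ sin ψ₂, cos ψ₁), d⊥ = (-sin ψ₂, cos ψ₂, 0), ρ = τ d + i τ ϑ d⊥ ∈ ℂ³, and u₀(x) = exp(ρ · x) for x ∈ ℝ³. Define A = -cos ψ₁, B = -sin ψ₁ sin ψ₂ - i ϑ cos ψ₂, C = -sin ψ₁ cos ψ₂ + i ϑ sin ψ₂, Z = C sin φ₀ - B cos φ₀, D = C cos φ₀ + B sin φ₀, and the unit directions x̂₁(φ) = (cos φ, sin φ, 0), x̂₂(θ) = (sin θ, 0, cos θ), x̂₃(θ) = (sin θ cos φ₀, sin θ sin φ₀, cos θ). Then all the iterated improper integrals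 below converge and A ∫_0^{φ₀} ∫_0^∞ u₀(r x̂₁(φ)) r dr dφ + B ∫_0^{π/2} ∫_0^∞ u₀(r x̂₂(θ)) r dr dθ + Z ∫_0^{π/2} ∫_0^∞ u₀(r x̂₃(θ)) r dr dθ = -(k²/τ⁴) · sin φ₀/(A C D). -/
open MeasureTheory

lemma radial_aux (c : ℂ) (hc : 0 < c.re) :
    IntegrableOn (fun r : ℝ => Complex.exp (-(c * (r : ℂ))) * (r : ℂ)) (Set.Ioi 0) ∧
    ∫ r in Set.Ioi (0 : ℝ), Complex.exp (-(c * (r : ℂ))) * (r : ℂ) = 1 / c ^ 2 := by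
  have hInteg : IntegrableOn
      (fun r : ℝ => Complex.exp (-(c * (r : ℂ))) * (r : ℂ)) (Set.Ioi 0) := by
    have h := integrableOn_rpow_mul_exp_neg_mul_rpow (s := 1) (p := 1) (b := c.re)
      (by norm_num) (by norm_num) hc
    refine Integrable.mono' h ?_ ?_
    · exact (by fun_prop : Continuous fun r : ℝ =>
        Complex.exp (-(c * (r : ℂ))) * (r : ℂ)).aestronglyMeasurable
    · refine (ae_restrict_iff' measurableSet_Ioi).2 (Filter.Eventually.of_forall ?_)
      intro r hr
      have hr : 0 < r := hr
      rw [norm_mul, Complex.norm_exp]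
      simp [abs_of_pos hr, mul_comm]
  refine ⟨hInteg, ?_⟩
  have hc0 : c ≠ 0 := by
    intro h
    rw [h] at hc
    simp at hc
  have hderiv : ∀ r ∈ Set.Ici (0 : ℝ), HasDerivAt
      (fun r : ℝ => -(Complex.exp (-(c * (r : ℂ))) * (r : ℂ)) / c
        - Complex.exp (-(c * (r : ℂ))) / c ^ 2)
      (Complex.exp (-(c * (r : ℂ))) * (r : ℂ)) r := by
    intro r _
    have h1 : HasDerivAt (fun r : ℝ => (r : ℂ)) 1 r := (hasDerivAt_id r).ofReal_comp
    have h2 := ((h1.const_mul c).neg).cexp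
    refine (((h2.mul h1).neg.div_const c).sub (h2.div_const (c ^ 2))).congr_deriv ?_
    simp only [Pi.neg_apply]
    field_simp
    ring
  have t1 : Filter.Tendsto (fun r : ℝ => Complex.exp (-(c * (r : ℂ))) * (r : ℂ))
      Filter.atTop (nhds 0) := by
    rw [tendsto_zero_iff_norm_tendsto_zero]
    refine (tendsto_rpow_mul_exp_neg_mul_atTop_nhds_zero 1 c.re hc).congr' ?_
    filter_upwards [Filter.eventually_gt_atTop 0] with r hr
    rw [norm_mul, Complex.norm_exp]
    simp [abs_of_pos hr, mul_comm]
  have t2 : Filter.Tendsto (fun r : ℝ => Complex.exp (-(c * (r : ℂ))))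
      Filter.atTop (nhds 0) := by
    rw [tendsto_zero_iff_norm_tendsto_zero]
    refine (tendsto_rpow_mul_exp_neg_mul_atTop_nhds_zero 0 c.re hc).congr' ?_
    filter_upwards [Filter.eventually_gt_atTop 0] with r hr
    rw [Complex.norm_exp]
    simp
  have h := integral_Ioi_of_hasDerivAt_of_tendsto' hderiv hInteg
    ((t1.neg.div_const c).sub (t2.div_const (c ^ 2)))
  rw [h]
  simp

lemma fan_aux (τ α : ℝ) (hτ : 0 < τ) (hα : 0 ≤ α) (P Q : ℂ)
    (hw : ∀ φ ∈ Set.Icc (0 : ℝ) α,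
      0 < (P * (Real.cos φ : ℂ) + Q * (Real.sin φ : ℂ)).re)
    (f : ℝ → ℝ → ℂ)
    (hf : ∀ φ r, f φ r = Complex.exp
      (-((τ : ℂ) * (P * (Real.cos φ : ℂ) + Q * (Real.sin φ : ℂ)) * (r : ℂ))) * (r : ℂ)) :
    (∀ φ ∈ Set.Icc (0 : ℝ) α, IntegrableOn (fun r : ℝ => f φ r) (Set.Ioi 0)) ∧
    IntervalIntegrable (fun φ : ℝ => ∫ r in Set.Ioi (0 : ℝ), f φ r) volume 0 α ∧
    ∫ φ in (0 : ℝ)..α, ∫ r in Set.Ioi (0 : ℝ), f φ r =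
      (Real.sin α : ℂ) / (P * (P * (Real.cos α : ℂ) + Q * (Real.sin α : ℂ))) / (τ : ℂ) ^ 2 := by
  have hre : ∀ φ ∈ Set.Icc (0 : ℝ) α,
      0 < ((τ : ℂ) * (P * (Real.cos φ : ℂ) + Q * (Real.sin φ : ℂ))).re := by
    intro φ hφ
    rw [Complex.re_ofReal_mul]
    exact mul_pos hτ (hw φ hφ)
  have hne : ∀ φ ∈ Set.Icc (0 : ℝ) α,
      P * (Real.cos φ : ℂ) + Q * (Real.sin φ : ℂ) ≠ 0 := by
    intro φ hφ h0
    have := hw φ hφ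
    rw [h0] at this
    simp at this
  have hP : P ≠ 0 := by
    have := hne 0 ⟨le_rfl, hα⟩
    simpa using this
  have hτ0 : (τ : ℂ) ≠ 0 := by exact_mod_cast hτ.ne'
  have hval : ∀ φ ∈ Set.Icc (0 : ℝ) α, ∫ r in Set.Ioi (0 : ℝ), f φ r =
      1 / ((τ : ℂ) * (P * (Real.cos φ : ℂ) + Q * (Real.sin φ : ℂ))) ^ 2 := by
    intro φ hφ
    simp only [hf]
    exact (radial_aux _ (hre φ hφ)).2
  have hcont : ContinuousOn (fun φ : ℝ =>
      1 / ((τ : ℂ) * (P * (Real.cos φ : ℂ) + Q * (Real.sin φ : ℂ))) ^ 2) (Set.uIcc 0 α) := by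
    rw [Set.uIcc_of_le hα]
    refine ContinuousOn.div continuousOn_const (Continuous.continuousOn (by fun_prop)) ?_
    intro φ hφ
    exact pow_ne_zero _ (mul_ne_zero hτ0 (hne φ hφ))
  have hInteg := hcont.intervalIntegrable (μ := volume)
  refine ⟨?_, ?_, ?_⟩
  · intro φ hφ
    simp only [hf]
    exact (radial_aux _ (hre φ hφ)).1
  · refine hInteg.congr ?_
    intro φ hφ
    rw [Set.uIoc_of_le hα] at hφ
    exact (hval φ ⟨hφ.1.le, hφ.2⟩).symm
  · rw [intervalIntegral.integral_congr (g := fun φ : ℝ =>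
      1 / ((τ : ℂ) * (P * (Real.cos φ : ℂ) + Q * (Real.sin φ : ℂ))) ^ 2)]
    · rw [intervalIntegral.integral_eq_sub_of_hasDerivAt (f := fun φ : ℝ =>
        (Real.sin φ : ℂ) / (P * (P * (Real.cos φ : ℂ) + Q * (Real.sin φ : ℂ))) / (τ : ℂ) ^ 2)
        ?_ hInteg]
      · simp
      · intro φ hφ
        rw [Set.uIcc_of_le hα] at hφ
        have h1 := (Real.hasDerivAt_sin φ).ofReal_comp
        have h2 := (Real.hasDerivAt_cos φ).ofReal_comp
        have hn := hne φ hφ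
        have h3 := (h1.div (((h2.const_mul P).add (h1.const_mul Q)).const_mul P)
          (mul_ne_zero hP hn)).div_const ((τ : ℂ) ^ 2)
        refine h3.congr_deriv ?_
        have hsc : (Real.sin φ : ℂ) ^ 2 + (Real.cos φ : ℂ) ^ 2 = 1 := by
          exact_mod_cast Real.sin_sq_add_cos_sq φ
        simp only [Pi.add_apply]
        rw [Complex.ofReal_neg]
        generalize (Real.sin φ : ℂ) = s at hsc hn ⊢
        generalize (Real.cos φ : ℂ) = c at hsc hn ⊢
        have e : c * (P * (P * c + Q * s)) - s * (P * (P * -s + Q * c)) = P ^ 2 := by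
          linear_combination P ^ 2 * hsc
        rw [e]
        field_simp
    · intro φ hφ
      rw [Set.uIcc_of_le hα] at hφ
      exact hval φ hφ

/-- Equations (eq u0) and (eq 622) of the paper: the closed-form leading-order
evaluation of the weighted surface integrals of the three-dimensional CGO solution over
the three planar fan-shaped faces of the test domain, swept to infinite radius. -/
theorem stmt_13 (k τ φ₀ ψ₁ ψ₂ : ℝ) (hk : 0 < k) (hτ : 0 < τ)
    (hφ₀ : φ₀ ∈ Set.Ioc 0 (Real.pi / 2))
    (hψ₁ : ψ₁ ∈ Set.Ioo (Real.pi / 2) Real.pi)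
    (hψ₂ : ψ₂ ∈ Set.Ioo (φ₀ + Real.pi / 2) (3 * Real.pi / 2)) :
    let ϑ : ℝ := Real.sqrt (1 + k ^ 2 / τ ^ 2)
    let d : Fin 3 → ℝ :=
      ![Real.sin ψ₁ * Real.cos ψ₂, Real.sin ψ₁ * Real.sin ψ₂, Real.cos ψ₁]
    let dp : Fin 3 → ℝ := ![-Real.sin ψ₂, Real.cos ψ₂, 0]
    let ρ : Fin 3 → ℂ := fun j =>
      ((τ * d j : ℝ) : ℂ) + Complex.I * ((τ * ϑ * dp j : ℝ) : ℂ)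
    let u₀ : (Fin 3 → ℝ) → ℂ := fun x => Complex.exp (∑ j, ρ j * (x j : ℂ))
    let A : ℂ := ((-Real.cos ψ₁ : ℝ) : ℂ)
    let B : ℂ := -((Real.sin ψ₁ * Real.sin ψ₂ : ℝ) : ℂ)
      - Complex.I * ((ϑ * Real.cos ψ₂ : ℝ) : ℂ)
    let C : ℂ := -((Real.sin ψ₁ * Real.cos ψ₂ : ℝ) : ℂ)
      + Complex.I * ((ϑ * Real.sin ψ₂ : ℝ) : ℂ)
    let Z : ℂ := C * (Real.sin φ₀ : ℂ) - B * (Real.cos φ₀ : ℂ)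
    let Dc : ℂ := C * (Real.cos φ₀ : ℂ) + B * (Real.sin φ₀ : ℂ)
    let x1 : ℝ → Fin 3 → ℝ := fun φ => ![Real.cos φ, Real.sin φ, 0]
    let x2 : ℝ → Fin 3 → ℝ := fun θ => ![Real.sin θ, 0, Real.cos θ]
    let x3 : ℝ → Fin 3 → ℝ := fun θ =>
      ![Real.sin θ * Real.cos φ₀, Real.sin θ * Real.sin φ₀, Real.cos θ]
    (∀ φ ∈ Set.Icc (0 : ℝ) φ₀,
      IntegrableOn (fun r : ℝ => u₀ (r • x1 φ) * (r : ℂ)) (Set.Ioi 0)) ∧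
    (∀ θ ∈ Set.Icc (0 : ℝ) (Real.pi / 2),
      IntegrableOn (fun r : ℝ => u₀ (r • x2 θ) * (r : ℂ)) (Set.Ioi 0)) ∧
    (∀ θ ∈ Set.Icc (0 : ℝ) (Real.pi / 2),
      IntegrableOn (fun r : ℝ => u₀ (r • x3 θ) * (r : ℂ)) (Set.Ioi 0)) ∧
    IntervalIntegrable
      (fun φ : ℝ => ∫ r in Set.Ioi (0 : ℝ), u₀ (r • x1 φ) * (r : ℂ)) volume 0 φ₀ ∧
    IntervalIntegrable
      (fun θ : ℝ => ∫ r in Set.Ioi (0 : ℝ), u₀ (r • x2 θ) * (r : ℂ)) volume 0 (Real.pi / 2) ∧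
    IntervalIntegrable
      (fun θ : ℝ => ∫ r in Set.Ioi (0 : ℝ), u₀ (r • x3 θ) * (r : ℂ)) volume 0 (Real.pi / 2) ∧
    A * (∫ φ in (0 : ℝ)..φ₀, ∫ r in Set.Ioi (0 : ℝ), u₀ (r • x1 φ) * (r : ℂ))
      + B * (∫ θ in (0 : ℝ)..(Real.pi / 2), ∫ r in Set.Ioi (0 : ℝ), u₀ (r • x2 θ) * (r : ℂ))
      + Z * (∫ θ in (0 : ℝ)..(Real.pi / 2), ∫ r in Set.Ioi (0 : ℝ), u₀ (r • x3 θ) * (r : ℂ))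
      = -(((k ^ 2 / τ ^ 4 : ℝ)) : ℂ) * (Real.sin φ₀ : ℂ) / (A * C * Dc) := by
  intro ϑ d dp ρ u₀ A B C Z Dc x1 x2 x3
  obtain ⟨hφ0, hφ1⟩ := hφ₀
  obtain ⟨hψ1, hψ1'⟩ := hψ₁
  obtain ⟨hψ2, hψ2'⟩ := hψ₂
  have hpi := Real.pi_pos
  have hs1 : 0 < Real.sin ψ₁ := Real.sin_pos_of_pos_of_lt_pi (by linarith) hψ1'
  have hc1 : Real.cos ψ₁ < 0 :=
    Real.cos_neg_of_pi_div_two_lt_of_lt hψ1 (by linarith)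
  have hw1 : ∀ φ ∈ Set.Icc (0 : ℝ) φ₀,
      0 < (C * (Real.cos φ : ℂ) + B * (Real.sin φ : ℂ)).re := by
    intro φ hφ
    have hc : Real.cos (ψ₂ - φ) < 0 :=
      Real.cos_neg_of_pi_div_two_lt_of_lt (by linarith [hφ.2]) (by linarith [hφ.1])
    have e : (C * (Real.cos φ : ℂ) + B * (Real.sin φ : ℂ)).re
        = -(Real.sin ψ₁ * Real.cos (ψ₂ - φ)) := by
      simp only [C, B, Complex.add_re, Complex.sub_re, Complex.neg_re, Complex.re_mul_ofReal,
        Complex.ofReal_re, Complex.I_re, Real.cos_sub]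
      ring
    rw [e]
    nlinarith
  have hCre : 0 < C.re := by
    have := hw1 0 ⟨le_rfl, hφ0.le⟩
    simpa using this
  have hDre : 0 < Dc.re := hw1 φ₀ ⟨hφ0.le, le_rfl⟩
  have hAre : 0 < A.re := by
    simp only [A, Complex.ofReal_re]; linarith
  have hw : ∀ Q : ℂ, 0 < Q.re → ∀ θ ∈ Set.Icc (0 : ℝ) (Real.pi / 2),
      0 < (A * (Real.cos θ : ℂ) + Q * (Real.sin θ : ℂ)).re := by
    intro Q hQ θ hθ
    rw [Complex.add_re, Complex.re_mul_ofReal, Complex.re_mul_ofReal]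
    have hc : 0 ≤ Real.cos θ := Real.cos_nonneg_of_mem_Icc ⟨by linarith [hθ.1], hθ.2⟩
    rcases hθ.1.eq_or_lt with h | h
    · rw [← h]; simpa using hAre
    · have hs : 0 < Real.sin θ := Real.sin_pos_of_pos_of_lt_pi h (by linarith [hθ.2])
      have := mul_pos hQ hs
      have := mul_nonneg hAre.le hc
      linarith
  obtain ⟨a1, b1, c1⟩ := fan_aux τ φ₀ hτ hφ0.le C B hw1
    (fun φ r => u₀ (r • x1 φ) * (r : ℂ)) (by
      intro φ r
      simp only [u₀, x1, ρ, d, dp, C, B, Fin.sum_univ_three, Pi.smul_apply, smul_eq_mul,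
        Matrix.cons_val]
      congr 2
      push_cast
      ring)
  obtain ⟨a2, b2, c2⟩ := fan_aux τ (Real.pi / 2) hτ (by linarith) A C (hw C hCre)
    (fun φ r => u₀ (r • x2 φ) * (r : ℂ)) (by
      intro φ r
      simp only [u₀, x2, ρ, d, dp, A, C, Fin.sum_univ_three, Pi.smul_apply, smul_eq_mul,
        Matrix.cons_val]
      congr 2
      push_cast
      ring)
  obtain ⟨a3, b3, c3⟩ := fan_aux τ (Real.pi / 2) hτ (by linarith) A Dc (hw Dc hDre)
    (fun φ r => u₀ (r • x3 φ) * (r : ℂ)) (by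
      intro φ r
      simp only [u₀, x3, ρ, d, dp, A, Dc, C, B, Fin.sum_univ_three, Pi.smul_apply, smul_eq_mul,
        Matrix.cons_val]
      congr 2
      push_cast
      ring)
  refine ⟨a1, a2, a3, b1, b2, b3, ?_⟩
  rw [c1, c2, c3]
  have hA0 : A ≠ 0 := by intro h; rw [h] at hAre; simp at hAre
  have hC0 : C ≠ 0 := by intro h; rw [h] at hCre; simp at hCre
  have hD0 : Dc ≠ 0 := by intro h; rw [h] at hDre; simp at hDre
  have hτ0 : (τ : ℂ) ≠ 0 := by exact_mod_cast hτ.ne'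
  have hϑ : (ϑ : ℂ) ^ 2 = 1 + (k : ℂ) ^ 2 / (τ : ℂ) ^ 2 := by
    have : ϑ ^ 2 = 1 + k ^ 2 / τ ^ 2 := Real.sq_sqrt (by positivity)
    exact_mod_cast this
  have e1 : (Real.sin ψ₁ : ℂ) ^ 2 + (Real.cos ψ₁ : ℂ) ^ 2 = 1 := by
    exact_mod_cast Real.sin_sq_add_cos_sq ψ₁
  have e2 : (Real.sin ψ₂ : ℂ) ^ 2 + (Real.cos ψ₂ : ℂ) ^ 2 = 1 := by
    exact_mod_cast Real.sin_sq_add_cos_sq ψ₂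
  have hsum : A ^ 2 + B ^ 2 + C ^ 2 = -((k : ℂ) ^ 2 / (τ : ℂ) ^ 2) := by
    simp only [A, B, C, Complex.ofReal_mul, Complex.ofReal_neg]
    linear_combination e1 - hϑ + ((Real.sin ψ₁ : ℂ) ^ 2 - (ϑ : ℂ) ^ 2) * e2
      + (ϑ : ℂ) ^ 2 * ((Real.sin ψ₂ : ℂ) ^ 2 + (Real.cos ψ₂ : ℂ) ^ 2) * Complex.I_sq
  have hZ : B * Dc + Z * C = (B ^ 2 + C ^ 2) * (Real.sin φ₀ : ℂ) := by
    simp only [Z, Dc]; ring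
  rw [Real.sin_pi_div_two, Real.cos_pi_div_two,
    show C * (Real.cos φ₀ : ℂ) + B * (Real.sin φ₀ : ℂ) = Dc from rfl]
  have hk2 : (((k ^ 2 / τ ^ 4 : ℝ)) : ℂ) = -(A ^ 2 + B ^ 2 + C ^ 2) / (τ : ℂ) ^ 2 := by
    rw [hsum]; push_cast; field_simp
  rw [hk2]
  clear_value A B C Z Dc
  simp only [Complex.ofReal_zero, Complex.ofReal_one, mul_zero, zero_add, mul_one]
  field_simp
  linear_combination hZ
end
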